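/- Let (G, ω, μ) be an infinite connected weighted graph carrying a pseudo metric d with finite jump size s, finite balls, which is 2-intrinsic with bound 1. Let V : G → ℝ with c₀ := inf_G V > 0. Let p ≥ 2 and β > 0 satisfy β² e^{2sβ} < 2c₀ p. If u solves Δu - Vu = 0 on G and ∑_{x∈G} |u(x)|^p e^{-β d(x,x₀)} μ(x) < ∞ for some x₀ ∈ G, then u ≡ 0. -/

import Mathlib

/-- Convexity of `|·|^q`, multiplied by `|a|^q`. -/
lemma aux_convex (q a b : ℝ) (hq : 1 ≤ q) :
    q * |a| ^ (2 * q - 2) * (a * (b - a)) ≤ |a| ^ q * (|b| ^ q - |a| ^ q) := by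
  rcases eq_or_ne a 0 with rfl | ha
  · have : (0 : ℝ) ^ q = 0 := Real.zero_rpow (by linarith)
    simp [this]
  have hA : 0 < |a| := abs_pos.mpr ha
  have h1 := one_add_mul_self_le_rpow_one_add (s := |b| / |a| - 1)
    (by have : 0 ≤ |b| / |a| := by positivity
        linarith) hq
  have e1 : (1 : ℝ) + (|b| / |a| - 1) = |b| / |a| := by ring
  rw [e1, Real.div_rpow (abs_nonneg _) (abs_nonneg _)] at h1
  have hAq : 0 < |a| ^ q := Real.rpow_pos_of_pos hA q
  have e2 : |a| ^ q * |a| ^ q = |a| ^ (2 * q - 2) * |a| ^ 2 := by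
    rw [← Real.rpow_add hA, ← Real.rpow_natCast |a| 2, ← Real.rpow_add hA]
    congr 1
    push_cast
    ring
  have h2 : |a| ^ q * (|a| ^ q * (1 + q * (|b| / |a| - 1))) ≤ |a| ^ q * |b| ^ q := by
    apply mul_le_mul_of_nonneg_left _ hAq.le
    rw [le_div_iff₀ hAq] at h1
    linarith
  have h3 : |a| ^ q * (|a| ^ q * (1 + q * (|b| / |a| - 1)))
      = |a| ^ q * |a| ^ q + q * |a| ^ (2 * q - 2) * (|a| * |b| - |a| ^ 2) := by
    rw [← mul_assoc, e2]
    field_simp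
  have h4 : a * (b - a) ≤ |a| * |b| - |a| ^ 2 := by
    rw [sq_abs, ← abs_mul]
    nlinarith [le_abs_self (a * b)]
  have h5 : q * |a| ^ (2 * q - 2) * (a * (b - a))
      ≤ q * |a| ^ (2 * q - 2) * (|a| * |b| - |a| ^ 2) := by
    apply mul_le_mul_of_nonneg_left h4
    have := Real.rpow_nonneg hA.le (2 * q - 2)
    positivity
  nlinarith

lemma aux_sq (q a : ℝ) (hq : 1 ≤ q) :
    |a| ^ (2 * q - 2) * (a * a) = (|a| ^ q) ^ 2 := by
  rcases eq_or_ne a 0 with rfl | ha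
  · have : (0 : ℝ) ^ q = 0 := Real.zero_rpow (by linarith)
    simp [this]
  have hA : 0 < |a| := abs_pos.mpr ha
  rw [← abs_mul_abs_self a, ← sq, ← Real.rpow_natCast |a| 2, ← Real.rpow_add hA,
    ← Real.rpow_natCast, ← Real.rpow_mul hA.le]
  congr 1
  push_cast
  ring

/-- Edge estimate, ordered case. -/
lemma aux_edge_ord (β s δ D r t a b : ℝ) (hβ : 0 < β) (hrt : r ≤ t) (hD : t - r ≤ D)
    (hDs : D ≤ s) (ha : 0 ≤ a) (hb : 0 ≤ b) :
    a * b * (max (Real.exp (-β * t / 2) - δ) 0 - max (Real.exp (-β * r / 2) - δ) 0) ^ 2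
      ≤ β ^ 2 / 8 * Real.exp (s * β) * D ^ 2 *
        (a ^ 2 * Real.exp (-β * r) + b ^ 2 * Real.exp (-β * t)) := by
  set P := Real.exp (-β * r / 2) with hP
  set Q := Real.exp (-β * t / 2) with hQ
  have hP0 : 0 < P := Real.exp_pos _
  have hQ0 : 0 < Q := Real.exp_pos _
  have hD0 : 0 ≤ D := by linarith
  have hs0 : 0 ≤ s := by linarith
  have hPP : Real.exp (-β * r) = P ^ 2 := by
    rw [hP, ← Real.exp_nat_mul]; congr 1; push_cast; ring
  have hQQ : Real.exp (-β * t) = Q ^ 2 := by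
    rw [hQ, ← Real.exp_nat_mul]; congr 1; push_cast; ring
  have hle : |max (Q - δ) 0 - max (P - δ) 0| ≤ |Q - P| := by
    have := abs_max_sub_max_le_abs (Q - δ) (P - δ) 0
    simpa using this
  have hQP : Q ≤ P := by
    apply Real.exp_le_exp.mpr
    nlinarith
  have hdiff : P - Q ≤ β * D / 2 * P := by
    have h1 : Q = P * Real.exp (-(β * (t - r) / 2)) := by
      rw [hP, hQ, ← Real.exp_add]; congr 1; ring
    have h2 := Real.add_one_le_exp (-(β * (t - r) / 2))
    have h3 : P * (-(β * (t - r) / 2) + 1) ≤ Q := by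
      rw [h1]; exact mul_le_mul_of_nonneg_left h2 hP0.le
    have h4 : P * (β * (t - r)) ≤ P * (β * D) := by gcongr
    nlinarith
  have hsq : (max (Q - δ) 0 - max (P - δ) 0) ^ 2 ≤ (β * D / 2 * P) ^ 2 := by
    rw [← sq_abs]
    apply pow_le_pow_left₀ (abs_nonneg _)
    refine hle.trans ?_
    rw [abs_sub_comm, abs_of_nonneg (by linarith)]
    exact hdiff
  have hE : 1 ≤ Real.exp (s * β) := Real.one_le_exp (by positivity)
  have hPQ : P ^ 2 ≤ Real.exp (s * β) * Q ^ 2 := by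
    rw [← hPP, ← hQQ, ← Real.exp_add]
    apply Real.exp_le_exp.mpr
    nlinarith
  rw [hPP, hQQ]
  have hab : a * b * P ^ 2 ≤ Real.exp (s * β) / 2 * (a ^ 2 * P ^ 2 + b ^ 2 * Q ^ 2) := by
    have h1 : a * b * P ^ 2 ≤ (a ^ 2 + b ^ 2) / 2 * P ^ 2 := by
      apply mul_le_mul_of_nonneg_right _ (by positivity)
      nlinarith [sq_nonneg (a - b)]
    have h2 : b ^ 2 * P ^ 2 ≤ b ^ 2 * (Real.exp (s * β) * Q ^ 2) :=
      mul_le_mul_of_nonneg_left hPQ (by positivity)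
    have h3 : 1 * (a ^ 2 * P ^ 2) ≤ Real.exp (s * β) * (a ^ 2 * P ^ 2) :=
      mul_le_mul_of_nonneg_right hE (by positivity)
    nlinarith
  calc a * b * (max (Q - δ) 0 - max (P - δ) 0) ^ 2
      ≤ a * b * (β * D / 2 * P) ^ 2 := mul_le_mul_of_nonneg_left hsq (by positivity)
    _ = β ^ 2 / 4 * D ^ 2 * (a * b * P ^ 2) := by ring
    _ ≤ β ^ 2 / 4 * D ^ 2 * (Real.exp (s * β) / 2 * (a ^ 2 * P ^ 2 + b ^ 2 * Q ^ 2)) :=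
        mul_le_mul_of_nonneg_left hab (by positivity)
    _ = _ := by ring

lemma aux_edge (β s δ D r t a b : ℝ) (hβ : 0 < β) (hD : t - r ≤ D) (hD' : r - t ≤ D)
    (hDs : D ≤ s) (ha : 0 ≤ a) (hb : 0 ≤ b) :
    a * b * (max (Real.exp (-β * t / 2) - δ) 0 - max (Real.exp (-β * r / 2) - δ) 0) ^ 2
      ≤ β ^ 2 / 8 * Real.exp (s * β) * D ^ 2 *
        (a ^ 2 * Real.exp (-β * r) + b ^ 2 * Real.exp (-β * t)) := by
  rcases le_total r t with h | h
  · exact aux_edge_ord β s δ D r t a b hβ h hD hDs ha hb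
  · have := aux_edge_ord β s δ D t r b a hβ h hD' hDs hb ha
    calc _ = b * a * (max (Real.exp (-β * r / 2) - δ) 0
            - max (Real.exp (-β * t / 2) - δ) 0) ^ 2 := by ring
      _ ≤ _ := this
      _ = _ := by ring


/-- Theorem 3.1: uniqueness in weighted ℓ^p, p ≥ 2, for the Schrödinger
equation on an infinite weighted graph. -/
theorem stmt16 {G : Type*} [Countable G] [Infinite G]
    (ω : G → G → ℝ) (μ : G → ℝ) (d : G → G → ℝ)
    (hω_nonneg : ∀ x y, 0 ≤ ω x y)
    (hω_symm : ∀ x y, ω x y = ω y x)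
    (hω_diag : ∀ x, ω x x = 0)
    (hω_sum : ∀ x, Summable fun y => ω x y)
    (hconn : ∀ x y : G, Relation.ReflTransGen (fun a b => 0 < ω a b) x y)
    (hμ : ∀ x, 0 < μ x)
    (hd_self : ∀ x, d x x = 0)
    (hd_symm : ∀ x y, d x y = d y x)
    (hd_tri : ∀ x y z, d x y ≤ d x z + d z y)
    (s : ℝ) (hs : 0 ≤ s) (hjump : ∀ x y, 0 < ω x y → d x y ≤ s)
    (hballs : ∀ (x : G) (r : ℝ), {y | d y x < r}.Finite)
    (hwsum : ∀ x, Summable fun y => ω x y * (d x y)^2)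
    (hintr : ∀ x, ∑' y, ω x y * (d x y)^2 ≤ μ x)
    (V : G → ℝ) (c₀ : ℝ) (hc₀ : 0 < c₀) (hV : ∀ x, c₀ ≤ V x)
    (p β : ℝ) (hp : 2 ≤ p) (hβ : 0 < β)
    (hβcond : β^2 * Real.exp (2 * s * β) < 2 * c₀ * p)
    (u : G → ℝ)
    (hu_sum : ∀ x, Summable fun y => (u y - u x) * ω x y)
    (hu : ∀ x, (μ x)⁻¹ * (∑' y, (u y - u x) * ω x y) - V x * u x = 0)
    (x₀ : G)
    (hℓp : Summable fun x => |u x| ^ p * Real.exp (-β * d x x₀) * μ x) :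
    ∀ x, u x = 0 := by
  set q : ℝ := p / 2 with hq
  have hq1 : 1 ≤ q := by rw [hq]; linarith
  set w : G → ℝ := fun x => |u x| ^ q with hw
  have hw0 : ∀ x, 0 ≤ w x := fun x => Real.rpow_nonneg (abs_nonneg _) _
  have hw2 : ∀ x, |u x| ^ p = w x ^ 2 := by
    intro x
    rw [hw, ← Real.rpow_natCast, ← Real.rpow_mul (abs_nonneg _), hq]
    congr 1
    push_cast
    ring
  set K : ℝ := β ^ 2 / 8 * Real.exp (s * β) with hK
  have hK0 : 0 ≤ K := by positivity
  simp only [hw2] at hℓp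
  set S : ℝ := ∑' x, w x ^ 2 * Real.exp (-β * d x x₀) * μ x with hS
  have hterm0 : ∀ x, 0 ≤ w x ^ 2 * Real.exp (-β * d x x₀) * μ x := fun x => by
    have := hμ x
    positivity
  set ψ : ℝ → G → ℝ := fun R x =>
    max (Real.exp (-β * d x x₀ / 2) - Real.exp (-β * R / 2)) 0 with hψ
  -- finite energy estimate
  have main : ∀ (R : ℝ) (F : Finset G),
      q * c₀ * ∑ x ∈ F, μ x * w x ^ 2 * ψ R x ^ 2 ≤ K * S := by
    intro R F
    have hψ0 : ∀ x, R ≤ d x x₀ → ψ R x = 0 := by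
      intro x hx
      simp only [hψ]
      apply max_eq_right
      have : Real.exp (-β * d x x₀ / 2) ≤ Real.exp (-β * R / 2) := by
        apply Real.exp_le_exp.mpr
        nlinarith
      linarith
    classical
    set B : Finset G := (hballs x₀ (R + s + 1)).toFinset ∪ F with hB
    -- pointwise inequality
    have hpt : ∀ x ∈ B, q * c₀ * (μ x * w x ^ 2 * ψ R x ^ 2)
        ≤ ∑ y ∈ B, ω x y * (w x * (w y - w x)) * ψ R x ^ 2 := by
      intro x _
      rcases le_or_gt R (d x x₀) with hx | hx
      · simp [hψ0 x hx]
      have hts : ∑' y, (u y - u x) * ω x y = ∑ y ∈ B, (u y - u x) * ω x y := by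
        apply tsum_eq_sum
        intro y hy
        have : ω x y = 0 := by
          by_contra hne
          have hpos : 0 < ω x y := lt_of_le_of_ne (hω_nonneg x y) (Ne.symm hne)
          apply hy
          rw [hB, Finset.mem_union]
          left
          simp only [Set.Finite.mem_toFinset, Set.mem_setOf_eq]
          have h1 := hjump x y hpos
          have h2 := hd_tri y x₀ x
          rw [hd_symm y x] at h2
          linarith
        simp [this]
      have heq : ∑ y ∈ B, (u y - u x) * ω x y = μ x * (V x * u x) := by
        have h1 := hu x
        rw [hts] at h1
        have h2 := (hμ x).ne'
        field_simp at h1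
        linarith
      rw [← Finset.sum_mul, ← mul_assoc]
      apply mul_le_mul_of_nonneg_right _ (sq_nonneg _)
      have hsum : q * |u x| ^ (2 * q - 2) * u x * ∑ y ∈ B, (u y - u x) * ω x y
          ≤ ∑ y ∈ B, ω x y * (w x * (w y - w x)) := by
        rw [Finset.mul_sum]
        apply Finset.sum_le_sum
        intro y _
        have := mul_le_mul_of_nonneg_left (aux_convex q (u x) (u y) hq1) (hω_nonneg x y)
        calc _ = ω x y * (q * |u x| ^ (2 * q - 2) * (u x * (u y - u x))) := by ring
          _ ≤ _ := this
      refine le_trans ?_ hsum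
      rw [heq]
      have e : q * |u x| ^ (2 * q - 2) * u x * (μ x * (V x * u x))
          = q * V x * (μ x * w x ^ 2) := by
        have := aux_sq q (u x) hq1
        calc _ = q * V x * (μ x * (|u x| ^ (2 * q - 2) * (u x * u x))) := by ring
          _ = _ := by rw [this]
      rw [e]
      have := hV x
      have := hμ x
      gcongr
    set T : ℝ := ∑ x ∈ B, ∑ y ∈ B, ω x y * (w x * (w y - w x)) * ψ R x ^ 2 with hT
    have h1 : q * c₀ * ∑ x ∈ B, μ x * w x ^ 2 * ψ R x ^ 2 ≤ T := by
      rw [Finset.mul_sum]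
      exact Finset.sum_le_sum hpt
    have hT' : T = ∑ x ∈ B, ∑ y ∈ B, ω x y * (w y * (w x - w y)) * ψ R y ^ 2 := by
      rw [hT, Finset.sum_comm]
      refine Finset.sum_congr rfl fun x _ => Finset.sum_congr rfl fun y _ => ?_
      rw [hω_symm y x]
    have h2 : T + T ≤ ∑ x ∈ B, ∑ y ∈ B, (K * (ω x y * d x y ^ 2) *
        (w x ^ 2 * Real.exp (-β * d x x₀)) + K * (ω x y * d x y ^ 2) *
        (w y ^ 2 * Real.exp (-β * d y x₀))) := by
      nth_rewrite 2 [hT']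
      rw [hT, ← Finset.sum_add_distrib]
      refine Finset.sum_le_sum fun x _ => ?_
      rw [← Finset.sum_add_distrib]
      refine Finset.sum_le_sum fun y _ => ?_
      have hid : ω x y * (w x * (w y - w x)) * ψ R x ^ 2
          + ω x y * (w y * (w x - w y)) * ψ R y ^ 2
          ≤ ω x y * (w x * w y * (ψ R y - ψ R x) ^ 2) := by
        have := mul_nonneg (hω_nonneg x y) (sq_nonneg (w y * ψ R y - w x * ψ R x))
        nlinarith
      refine hid.trans ?_
      rcases (hω_nonneg x y).eq_or_lt with h0 | hpos
      · simp [← h0]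
      have t1 := hd_tri y x₀ x
      have t2 := hd_tri x x₀ y
      rw [hd_symm y x] at t1
      have := aux_edge β s (Real.exp (-β * R / 2)) (d x y) (d x x₀) (d y x₀) (w x) (w y) hβ
        (by linarith) (by linarith) (hjump x y hpos) (hw0 x) (hw0 y)
      calc _ ≤ ω x y * (β ^ 2 / 8 * Real.exp (s * β) * d x y ^ 2 *
        (w x ^ 2 * Real.exp (-β * d x x₀) + w y ^ 2 * Real.exp (-β * d y x₀))) :=
              mul_le_mul_of_nonneg_left this hpos.le
        _ = _ := by rw [hK]; ring
    have h3 : ∑ x ∈ B, ∑ y ∈ B, K * (ω x y * d x y ^ 2) *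
        (w x ^ 2 * Real.exp (-β * d x x₀)) ≤ K * S := by
      calc _ ≤ ∑ x ∈ B, K * (w x ^ 2 * Real.exp (-β * d x x₀) * μ x) := by
            refine Finset.sum_le_sum fun x _ => ?_
            rw [← Finset.sum_mul, ← Finset.mul_sum]
            have hle : ∑ y ∈ B, ω x y * d x y ^ 2 ≤ μ x :=
              ((hwsum x).sum_le_tsum B
                (fun y _ => mul_nonneg (hω_nonneg x y) (sq_nonneg _))).trans (hintr x)
            calc _ ≤ K * μ x * (w x ^ 2 * Real.exp (-β * d x x₀)) := by gcongr
              _ = _ := by ring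
        _ = K * ∑ x ∈ B, (w x ^ 2 * Real.exp (-β * d x x₀) * μ x) := by
            rw [Finset.mul_sum]
        _ ≤ K * S := mul_le_mul_of_nonneg_left
            (hℓp.sum_le_tsum B (fun x _ => hterm0 x)) hK0
    have h4 : ∑ x ∈ B, ∑ y ∈ B, K * (ω x y * d x y ^ 2) *
        (w y ^ 2 * Real.exp (-β * d y x₀)) ≤ K * S := by
      rw [Finset.sum_comm]
      refine le_trans (le_of_eq ?_) h3
      refine Finset.sum_congr rfl fun x _ => Finset.sum_congr rfl fun y _ => ?_
      rw [hω_symm y x, hd_symm y x]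
    simp only [Finset.sum_add_distrib] at h2
    have h5 : ∑ x ∈ F, μ x * w x ^ 2 * ψ R x ^ 2 ≤ ∑ x ∈ B, μ x * w x ^ 2 * ψ R x ^ 2 := by
      apply Finset.sum_le_sum_of_subset_of_nonneg Finset.subset_union_right
      intro x _ _
      have := hμ x
      positivity
    have h6 : q * c₀ * ∑ x ∈ F, μ x * w x ^ 2 * ψ R x ^ 2
        ≤ q * c₀ * ∑ x ∈ B, μ x * w x ^ 2 * ψ R x ^ 2 :=
      mul_le_mul_of_nonneg_left h5 (by positivity)
    linarith
  -- let R → ∞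
  have lim : ∀ F : Finset G,
      q * c₀ * ∑ x ∈ F, w x ^ 2 * Real.exp (-β * d x x₀) * μ x ≤ K * S := by
    intro F
    have hδ : Filter.Tendsto (fun R : ℝ => Real.exp (-β * R / 2)) Filter.atTop (nhds 0) := by
      apply Real.tendsto_exp_atBot.comp
      have : (fun R : ℝ => -β * R / 2) = fun R => (-β / 2) * R := by funext R; ring
      rw [this]
      exact Filter.tendsto_id.const_mul_atTop_of_neg (by linarith)
    have ht : Filter.Tendsto (fun R => q * c₀ * ∑ x ∈ F, μ x * w x ^ 2 * ψ R x ^ 2)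
        Filter.atTop (nhds (q * c₀ * ∑ x ∈ F, μ x * w x ^ 2 *
          (max (Real.exp (-β * d x x₀ / 2) - 0) 0) ^ 2)) := by
      apply Filter.Tendsto.const_mul
      apply tendsto_finsetSum
      intro x _
      apply Filter.Tendsto.const_mul
      apply Filter.Tendsto.pow
      exact (tendsto_const_nhds.sub hδ).max tendsto_const_nhds
    have h := le_of_tendsto' ht (fun R => main R F)
    refine le_trans (le_of_eq ?_) h
    congr 1
    refine Finset.sum_congr rfl fun x _ => ?_
    rw [sub_zero, max_eq_left (Real.exp_pos _).le, ← Real.exp_nat_mul]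
    have : ((2 : ℕ) : ℝ) * (-β * d x x₀ / 2) = -β * d x x₀ := by push_cast; ring
    rw [this]
    ring
  have hfin : q * c₀ * S ≤ K * S :=
    le_of_tendsto' (Filter.Tendsto.const_mul (q * c₀) hℓp.hasSum) lim
  have hKlt : K < q * c₀ := by
    have h1 : Real.exp (s * β) ≤ Real.exp (2 * s * β) := by
      apply Real.exp_le_exp.mpr
      nlinarith [mul_nonneg hs hβ.le]
    have h2 : β ^ 2 * Real.exp (s * β) ≤ β ^ 2 * Real.exp (2 * s * β) :=
      mul_le_mul_of_nonneg_left h1 (sq_nonneg _)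
    have h3 : 0 < c₀ * p := by positivity
    rw [hK, hq]
    nlinarith
  have hS0 : 0 ≤ S := tsum_nonneg hterm0
  have hSz : S = 0 := by nlinarith
  intro x
  have hx : w x ^ 2 * Real.exp (-β * d x x₀) * μ x ≤ 0 := by
    rw [← hSz]
    exact hℓp.le_tsum x (fun y _ => hterm0 y)
  have hx0 := le_antisymm hx (hterm0 x)
  have hwx : w x = 0 := by
    have h1 := (hμ x).ne'
    have h2 := (Real.exp_pos (-β * d x x₀)).ne'
    simpa [h1, h2] using hx0
  have := (Real.rpow_eq_zero (abs_nonneg (u x)) (by positivity : q ≠ 0)).mp hwx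
  exact abs_eq_zero.mp this
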